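/- Let J : 𝒜 → ℰ be a pseudofunctor, T a J-relative pseudomonad, and (A, (-)^a, â, ã), (B, (-)^b, b̂, b̃) lax-idempotent T-pseudoalgebras. Every 1-cell ℓ : A → B of ℰ that admits a right adjoint in ℰ is a pseudomorphism of T-pseudoalgebras: its unique lax morphism structure has invertible components. -/

import Mathlib

open CategoryTheory Bicategory

universe w₁ v₁ u₁ w₂ v₂ u₂

section RelPsMnd

variable {𝒜 : Type u₁} [Bicategory.{w₁, v₁} 𝒜] {ℰ : Type u₂} [Bicategory.{w₂, v₂} ℰ]

/-- Precomposition with a fixed 1-cell, as a functor between hom-categories. -/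
@[simps]
def precompF {a b : ℰ} (c : ℰ) (f : a ⟶ b) : (b ⟶ c) ⥤ (a ⟶ c) where
  obj g := f ≫ g
  map η := f ◁ η

/-- A pseudomonad relative to a pseudofunctor `J : 𝒜 ⥤ ℰ`, given in extension form:
an object assignment, extension operators, units, and invertible coherence 2-cells
`mul` (μ), `eta` (η), `theta` (θ) subject to associativity and unit laws. -/
structure RelativePseudomonad (J : Pseudofunctor 𝒜 ℰ) where
  obj : 𝒜 → ℰ
  unit : ∀ X : 𝒜, J.obj X ⟶ obj X
  ext : ∀ {X Y : 𝒜}, (J.obj X ⟶ obj Y) ⥤ (obj X ⟶ obj Y)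
  mul : ∀ {X Y Z : 𝒜} (f : J.obj X ⟶ obj Y) (g : J.obj Y ⟶ obj Z),
    ext.obj (f ≫ ext.obj g) ≅ ext.obj f ≫ ext.obj g
  eta : ∀ {X Y : 𝒜} (f : J.obj X ⟶ obj Y), f ≅ unit X ≫ ext.obj f
  theta : ∀ X : 𝒜, ext.obj (unit X) ≅ 𝟙 (obj X)
  mul_natural : ∀ {X Y Z : 𝒜} {f f' : J.obj X ⟶ obj Y} {g g' : J.obj Y ⟶ obj Z}
    (α : f ⟶ f') (β : g ⟶ g'),
    ext.map (α ▷ ext.obj g ≫ f' ◁ ext.map β) ≫ (mul f' g').hom =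
      (mul f g).hom ≫ (ext.map α ▷ ext.obj g ≫ ext.obj f' ◁ ext.map β)
  eta_natural : ∀ {X Y : 𝒜} {f f' : J.obj X ⟶ obj Y} (α : f ⟶ f'),
    α ≫ (eta f').hom = (eta f).hom ≫ unit X ◁ ext.map α
  assoc : ∀ {W X Y Z : 𝒜} (f : J.obj W ⟶ obj X) (g : J.obj X ⟶ obj Y)
    (h : J.obj Y ⟶ obj Z),
    (mul f (g ≫ ext.obj h)).hom ≫ ext.obj f ◁ (mul g h).hom =
      ext.map (f ◁ (mul g h).hom) ≫ ext.map (α_ f (ext.obj g) (ext.obj h)).inv ≫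
        (mul (f ≫ ext.obj g) h).hom ≫ (mul f g).hom ▷ ext.obj h ≫
        (α_ (ext.obj f) (ext.obj g) (ext.obj h)).hom
  unit_law : ∀ {X Y : 𝒜} (f : J.obj X ⟶ obj Y),
    ext.map (eta f).hom ≫ (mul (unit X) f).hom ≫ (theta X).hom ▷ ext.obj f =
      (λ_ (ext.obj f)).inv

namespace RelativePseudomonad

variable {J : Pseudofunctor 𝒜 ℰ} (T : RelativePseudomonad J)

/-- The data of a pseudoalgebra for a relative pseudomonad on a carrier `C`:
extension operators `ext`, associativity 2-cells `ahat` (â) and unit 2-cells `atil` (ã). -/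
structure AlgData (C : ℰ) where
  ext : ∀ (X : 𝒜), (J.obj X ⟶ C) ⥤ (T.obj X ⟶ C)
  ahat : ∀ {X Y : 𝒜} (f : J.obj X ⟶ T.obj Y) (g : J.obj Y ⟶ C),
    (ext X).obj (f ≫ (ext Y).obj g) ≅ T.ext.obj f ≫ (ext Y).obj g
  atil : ∀ {X : 𝒜} (f : J.obj X ⟶ C), f ≅ T.unit X ≫ (ext X).obj f

/-- The pseudoalgebra axioms. -/
structure AlgData.Laws {C : ℰ} (S : T.AlgData C) : Prop where
  ahat_natural : ∀ {X Y : 𝒜} {f f' : J.obj X ⟶ T.obj Y} {g g' : J.obj Y ⟶ C}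
    (α : f ⟶ f') (β : g ⟶ g'),
    (S.ext X).map (α ▷ (S.ext Y).obj g ≫ f' ◁ (S.ext Y).map β) ≫ (S.ahat f' g').hom =
      (S.ahat f g).hom ≫ (T.ext.map α ▷ (S.ext Y).obj g ≫ T.ext.obj f' ◁ (S.ext Y).map β)
  atil_natural : ∀ {X : 𝒜} {f f' : J.obj X ⟶ C} (α : f ⟶ f'),
    α ≫ (S.atil f').hom = (S.atil f).hom ≫ T.unit X ◁ (S.ext X).map α
  assoc : ∀ {W X Y : 𝒜} (f : J.obj W ⟶ T.obj X) (g : J.obj X ⟶ T.obj Y)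
    (h : J.obj Y ⟶ C),
    (S.ahat f (g ≫ (S.ext Y).obj h)).hom ≫ T.ext.obj f ◁ (S.ahat g h).hom =
      (S.ext W).map (f ◁ (S.ahat g h).hom) ≫
        (S.ext W).map (α_ f (T.ext.obj g) ((S.ext Y).obj h)).inv ≫
        (S.ahat (f ≫ T.ext.obj g) h).hom ≫ (T.mul f g).hom ▷ (S.ext Y).obj h ≫
        (α_ (T.ext.obj f) (T.ext.obj g) ((S.ext Y).obj h)).hom
  unit : ∀ {X : 𝒜} (f : J.obj X ⟶ C),
    (S.ext X).map (S.atil f).hom ≫ (S.ahat (T.unit X) f).hom ≫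
      (T.theta X).hom ▷ (S.ext X).obj f = (λ_ ((S.ext X).obj f)).inv

/-- A pseudoalgebra: data together with the laws. -/
structure Algebra (C : ℰ) extends AlgData T C where
  laws : toAlgData.Laws

/-- The data of the free pseudoalgebra on an object of `𝒜`. -/
@[simps]
def freeAlgData (X : 𝒜) : T.AlgData (T.obj X) where
  ext _ := T.ext
  ahat f g := T.mul f g
  atil f := T.eta f

theorem freeAlgData_laws (X : 𝒜) : (T.freeAlgData X).Laws where
  ahat_natural := T.mul_natural
  atil_natural := T.eta_natural
  assoc := T.assoc
  unit := T.unit_law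

/-- The free pseudoalgebra on `X`. -/
def freeAlgebra (X : 𝒜) : T.Algebra (T.obj X) := ⟨T.freeAlgData X, T.freeAlgData_laws X⟩

variable {T}

/-- The data of a lax morphism of pseudoalgebras: a 1-cell between the carriers
together with the comparison 2-cells `lax`. -/
structure LaxData {C C' : ℰ} (S : T.AlgData C) (S' : T.AlgData C') where
  hom : C ⟶ C'
  lax : ∀ (X : 𝒜) (f : J.obj X ⟶ C),
    (S'.ext X).obj (f ≫ hom) ⟶ (S.ext X).obj f ≫ hom

/-- The axioms for a lax morphism of pseudoalgebras. -/
structure LaxData.IsLaxMorphism {C C' : ℰ} {S : T.AlgData C} {S' : T.AlgData C'}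
    (m : LaxData S S') : Prop where
  natural : ∀ {X : 𝒜} {f f' : J.obj X ⟶ C} (α : f ⟶ f'),
    (S'.ext X).map (α ▷ m.hom) ≫ m.lax X f' = m.lax X f ≫ (S.ext X).map α ▷ m.hom
  unit : ∀ {X : 𝒜} (f : J.obj X ⟶ C),
    (S'.atil (f ≫ m.hom)).hom ≫ T.unit X ◁ m.lax X f =
      (S.atil f).hom ▷ m.hom ≫ (α_ (T.unit X) ((S.ext X).obj f) m.hom).hom
  assoc : ∀ {X Y : 𝒜} (f : J.obj X ⟶ T.obj Y) (g : J.obj Y ⟶ C),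
    (S'.ahat f (g ≫ m.hom)).hom ≫ T.ext.obj f ◁ m.lax Y g ≫
        (α_ (T.ext.obj f) ((S.ext Y).obj g) m.hom).inv =
      (S'.ext X).map (f ◁ m.lax Y g) ≫
        (S'.ext X).map (α_ f ((S.ext Y).obj g) m.hom).inv ≫
        m.lax X (f ≫ (S.ext Y).obj g) ≫ (S.ahat f g).hom ▷ m.hom

/-- Pseudomorphisms are lax morphisms whose comparison 2-cells are invertible. -/
def LaxData.IsPseudoMorphism {C C' : ℰ} {S : T.AlgData C} {S' : T.AlgData C'}
    (m : LaxData S S') : Prop :=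
  m.IsLaxMorphism ∧ ∀ (X : 𝒜) (f : J.obj X ⟶ C), IsIso (m.lax X f)

/-- The data of a colax morphism of pseudoalgebras. -/
structure ColaxData {C C' : ℰ} (S : T.AlgData C) (S' : T.AlgData C') where
  hom : C ⟶ C'
  colax : ∀ (X : 𝒜) (f : J.obj X ⟶ C),
    (S.ext X).obj f ≫ hom ⟶ (S'.ext X).obj (f ≫ hom)

/-- The axioms for a colax morphism of pseudoalgebras. -/
structure ColaxData.IsColaxMorphism {C C' : ℰ} {S : T.AlgData C} {S' : T.AlgData C'}
    (m : ColaxData S S') : Prop where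
  natural : ∀ {X : 𝒜} {f f' : J.obj X ⟶ C} (α : f ⟶ f'),
    m.colax X f ≫ (S'.ext X).map (α ▷ m.hom) = (S.ext X).map α ▷ m.hom ≫ m.colax X f'
  unit : ∀ {X : 𝒜} (f : J.obj X ⟶ C),
    (S.atil f).hom ▷ m.hom ≫ (α_ (T.unit X) ((S.ext X).obj f) m.hom).hom ≫
        T.unit X ◁ m.colax X f =
      (S'.atil (f ≫ m.hom)).hom
  assoc : ∀ {X Y : 𝒜} (f : J.obj X ⟶ T.obj Y) (g : J.obj Y ⟶ C),
    (S.ahat f g).hom ▷ m.hom ≫ (α_ (T.ext.obj f) ((S.ext Y).obj g) m.hom).hom ≫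
        T.ext.obj f ◁ m.colax Y g =
      m.colax X (f ≫ (S.ext Y).obj g) ≫
        (S'.ext X).map (α_ f ((S.ext Y).obj g) m.hom).hom ≫
        (S'.ext X).map (f ◁ m.colax Y g) ≫ (S'.ahat f (g ≫ m.hom)).hom

/-- A 2-cell between (the underlying 1-cells of) two lax morphisms is a transformation. -/
def IsTransformation {C C' : ℰ} {S : T.AlgData C} {S' : T.AlgData C'}
    (m m' : LaxData S S') (α : m.hom ⟶ m'.hom) : Prop :=
  ∀ (X : 𝒜) (f : J.obj X ⟶ C),
    (S'.ext X).map (f ◁ α) ≫ m'.lax X f = m.lax X f ≫ (S.ext X).obj f ◁ α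

/-- A 2-cell between (the underlying 1-cells of) two colax morphisms is a transformation. -/
def IsColaxTransformation {C C' : ℰ} {S : T.AlgData C} {S' : T.AlgData C'}
    (m m' : ColaxData S S') (α : m.hom ⟶ m'.hom) : Prop :=
  ∀ (X : 𝒜) (f : J.obj X ⟶ C),
    (S.ext X).obj f ◁ α ≫ m'.colax X f = m.colax X f ≫ (S'.ext X).map (f ◁ α)

/-- The identity lax morphism data, with the canonical comparison 2-cells
`(1 ∘ f)^a ≅ f^a ≅ 1 ∘ f^a`. -/
@[simps]
def idLaxData {C : ℰ} (S : T.AlgData C) : LaxData S S where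
  hom := 𝟙 C
  lax X f := (S.ext X).map (ρ_ f).hom ≫ (ρ_ ((S.ext X).obj f)).inv

/-- The composite of two lax morphism data. -/
@[simps]
def compLaxData {C C' C'' : ℰ} {S : T.AlgData C} {S' : T.AlgData C'} {S'' : T.AlgData C''}
    (m : LaxData S S') (m' : LaxData S' S'') : LaxData S S'' where
  hom := m.hom ≫ m'.hom
  lax X f :=
    (S''.ext X).map (α_ f m.hom m'.hom).inv ≫ m'.lax X (f ≫ m.hom) ≫
      m.lax X f ▷ m'.hom ≫ (α_ ((S.ext X).obj f) m.hom m'.hom).hom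

/-- The identity colax morphism data. -/
@[simps]
def idColaxData {C : ℰ} (S : T.AlgData C) : ColaxData S S where
  hom := 𝟙 C
  colax X f := (ρ_ ((S.ext X).obj f)).hom ≫ (S.ext X).map (ρ_ f).inv

/-- The composite of two colax morphism data. -/
@[simps]
def compColaxData {C C' C'' : ℰ} {S : T.AlgData C} {S' : T.AlgData C'} {S'' : T.AlgData C''}
    (m : ColaxData S S') (m' : ColaxData S' S'') : ColaxData S S'' where
  hom := m.hom ≫ m'.hom
  colax X f :=
    (α_ ((S.ext X).obj f) m.hom m'.hom).inv ≫ m.colax X f ▷ m'.hom ≫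
      m'.colax X (f ≫ m.hom) ≫ (S''.ext X).map (α_ f m.hom m'.hom).hom

/-- Morphisms of pseudoalgebras satisfying a property `P` (e.g. lax morphisms,
pseudomorphisms), which form a category under transformations. -/
def Mor {C C' : ℰ} (S : T.AlgData C) (S' : T.AlgData C') (P : LaxData S S' → Prop) :=
  { m : LaxData S S' // P m }

instance morCategory {C C' : ℰ} (S : T.AlgData C) (S' : T.AlgData C')
    (P : LaxData S S' → Prop) : Category (Mor S S' P) where
  Hom m m' := { α : m.val.hom ⟶ m'.val.hom // IsTransformation m.val m'.val α }
  id m := ⟨𝟙 m.val.hom, by intro X f; simp⟩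
  comp {m m' m''} α β := ⟨α.val ≫ β.val, by
    intro X f
    have hα := α.property X f
    have hβ := β.property X f
    simp only [Bicategory.whiskerLeft_comp, Functor.map_comp, Category.assoc]
    rw [hβ, ← Category.assoc, hα, Category.assoc]⟩
  id_comp := by intros; apply Subtype.ext; simp
  comp_id := by intros; apply Subtype.ext; simp
  assoc := by intros; apply Subtype.ext; simp

/-- The forgetful functor from a category of morphisms of pseudoalgebras and
transformations to the corresponding hom-category of `ℰ`. -/
@[simps]
def morForget {C C' : ℰ} (S : T.AlgData C) (S' : T.AlgData C') (P : LaxData S S' → Prop) :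
    Mor S S' P ⥤ (C ⟶ C') where
  obj m := m.val.hom
  map α := α.val

/-- A pseudoalgebra is lax-idempotent when its unit 2-cells `atil` exhibit the unit of
an adjunction between extension and precomposition with the unit of the pseudomonad. -/
def IsLaxIdempotent {C : ℰ} (S : T.AlgData C) : Prop :=
  ∀ X : 𝒜, ∃ adj : S.ext X ⊣ precompF C (T.unit X),
    ∀ f : J.obj X ⟶ C, adj.unit.app f = (S.atil f).hom

section Mates

variable {C C' : ℰ} {S : T.AlgData C} {S' : T.AlgData C'} {l : C ⟶ C'} {r : C' ⟶ C}

/-- The 2-cell `f ⇒ rℓf` obtained by whiskering the unit of an adjunction. -/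
def nuW (adj : Bicategory.Adjunction l r) {a : ℰ} (f : a ⟶ C) : f ⟶ (f ≫ l) ≫ r :=
  (ρ_ f).inv ≫ f ◁ adj.unit ≫ (α_ f l r).inv

/-- The 2-cell `ℓrg ⇒ g` obtained by whiskering the counit of an adjunction. -/
def epsW (adj : Bicategory.Adjunction l r) {a : ℰ} (g : a ⟶ C') : (g ≫ r) ≫ l ⟶ g :=
  (α_ g r l).hom ≫ g ◁ adj.counit ≫ (ρ_ g).hom

/-- The colax morphism structure on a left adjoint `ℓ` obtained as the mate of a lax
morphism structure on its right adjoint `r`. -/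
def colaxMate (adj : Bicategory.Adjunction l r)
    (rl : ∀ (X : 𝒜) (g : J.obj X ⟶ C'), (S.ext X).obj (g ≫ r) ⟶ (S'.ext X).obj g ≫ r) :
    ∀ (X : 𝒜) (f : J.obj X ⟶ C), (S.ext X).obj f ≫ l ⟶ (S'.ext X).obj (f ≫ l) :=
  fun X f =>
    (S.ext X).map (nuW adj f) ▷ l ≫ rl X (f ≫ l) ▷ l ≫
      (α_ ((S'.ext X).obj (f ≫ l)) r l).hom ≫ (S'.ext X).obj (f ≫ l) ◁ adj.counit ≫
      (ρ_ ((S'.ext X).obj (f ≫ l))).hom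

/-- The lax morphism structure on a right adjoint `r` obtained as the mate of a colax
morphism structure on its left adjoint `ℓ`. -/
def laxMate (adj : Bicategory.Adjunction l r)
    (lc : ∀ (X : 𝒜) (f : J.obj X ⟶ C), (S.ext X).obj f ≫ l ⟶ (S'.ext X).obj (f ≫ l)) :
    ∀ (X : 𝒜) (g : J.obj X ⟶ C'), (S.ext X).obj (g ≫ r) ⟶ (S'.ext X).obj g ≫ r :=
  fun X g =>
    (ρ_ ((S.ext X).obj (g ≫ r))).inv ≫ (S.ext X).obj (g ≫ r) ◁ adj.unit ≫
      (α_ ((S.ext X).obj (g ≫ r)) l r).inv ≫ lc X (g ≫ r) ▷ r ≫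
      (S'.ext X).map (epsW adj g) ▷ r

end Mates

end RelativePseudomonad

end RelPsMnd

namespace RelativePseudomonad

section LaxIdempotent

variable {𝒜 : Type u₁} [Bicategory.{w₁, v₁} 𝒜] {ℰ : Type u₂} [Bicategory.{w₂, v₂} ℰ]
  {J : Pseudofunctor 𝒜 ℰ} {T : RelativePseudomonad J} {C C' : ℰ}

/-- In a lax-idempotent pseudoalgebra, 2-cells out of an extension `f^a` correspond to
2-cells out of `f`. -/
theorem IsLaxIdempotent.bijective_transpose {S : T.AlgData C} (hS : IsLaxIdempotent S)
    {X : 𝒜} (f : J.obj X ⟶ C) (h : T.obj X ⟶ C) :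
    Function.Bijective
      (fun k : (S.ext X).obj f ⟶ h ↦ (S.atil f).hom ≫ T.unit X ◁ k) := by
  obtain ⟨adj, hadj⟩ := hS X
  have e : (fun k : (S.ext X).obj f ⟶ h ↦ (S.atil f).hom ≫ T.unit X ◁ k) =
      adj.homEquiv f h := by
    funext k
    rw [adj.homEquiv_unit, hadj]
    rfl
  rw [e]
  exact (adj.homEquiv f h).bijective

theorem IsLaxIdempotent.hom_ext {S : T.AlgData C} (hS : IsLaxIdempotent S)
    {X : 𝒜} {f : J.obj X ⟶ C} {h : T.obj X ⟶ C} {k k' : (S.ext X).obj f ⟶ h}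
    (w : (S.atil f).hom ≫ T.unit X ◁ k = (S.atil f).hom ≫ T.unit X ◁ k') : k = k' :=
  (hS.bijective_transpose f h).injective w

/-- The extension operator of a pseudoalgebra is faithful, since composing it with the unit
is isomorphic to the identity. -/
theorem AlgData.Laws.map_injective {S : T.AlgData C} (hS : S.Laws) {X : 𝒜}
    {f f' : J.obj X ⟶ C} {α β : f ⟶ f'} (w : (S.ext X).map α = (S.ext X).map β) : α = β := by
  rw [← cancel_mono (S.atil f').hom, hS.atil_natural, hS.atil_natural, w]

/-- The left unit law of a pseudoalgebra, which is a consequence of the other laws. -/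
theorem AlgData.Laws.atil_ahat {S : T.AlgData C} (hS : S.Laws) {X Y : 𝒜}
    (f : J.obj X ⟶ T.obj Y) (g : J.obj Y ⟶ C) :
    (S.atil (f ≫ (S.ext Y).obj g)).hom ≫ T.unit X ◁ (S.ahat f g).hom =
      (T.eta f).hom ▷ (S.ext Y).obj g ≫
        (α_ (T.unit X) (T.ext.obj f) ((S.ext Y).obj g)).hom := by
  rw [← cancel_mono (α_ (T.unit X) (T.ext.obj f) ((S.ext Y).obj g)).inv]
  apply hS.map_injective
  have hnat := hS.ahat_natural (T.eta f).hom (𝟙 g)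
  have hassoc := hS.assoc (T.unit X) f g
  have hunit := hS.unit (f ≫ (S.ext Y).obj g)
  have hT := T.unit_law f
  simp only [CategoryTheory.Functor.map_id, Bicategory.whiskerLeft_id, Category.comp_id] at hnat
  rw [← cancel_mono (S.ahat (T.unit X ≫ T.ext.obj f) g).hom,
    ← cancel_mono ((T.mul (T.unit X) f).hom ▷ (S.ext Y).obj g),
    ← cancel_mono ((T.theta X).hom ▷ T.ext.obj f ▷ (S.ext Y).obj g)]
  simp only [CategoryTheory.Functor.map_comp, Category.assoc, Iso.hom_inv_id, Category.comp_id]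
  rw [reassoc_of% hnat, ← comp_whiskerRight, ← comp_whiskerRight, hT]
  rw [← cancel_mono (α_ (𝟙 _) (T.ext.obj f) ((S.ext Y).obj g)).hom]
  simp only [Category.assoc, comp_whiskerRight, associator_naturality_left]
  rw [← reassoc_of% hassoc, whisker_exchange, reassoc_of% hunit]
  simp

/-- Every 1-cell into a lax-idempotent pseudoalgebra admits a lax morphism structure, obtained
by transposing the unit 2-cells. -/
theorem IsLaxIdempotent.exists_isLaxMorphism {S : T.AlgData C} {S' : T.AlgData C'}
    (hS : S.Laws) (hS' : S'.Laws) (hLI : IsLaxIdempotent S') (ℓ : C ⟶ C') :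
    ∃ l : ∀ (X : 𝒜) (f : J.obj X ⟶ C), (S'.ext X).obj (f ≫ ℓ) ⟶ (S.ext X).obj f ≫ ℓ,
      (⟨ℓ, l⟩ : LaxData S S').IsLaxMorphism := by
  choose l hl using fun (X : 𝒜) (f : J.obj X ⟶ C) ↦
    (hLI.bijective_transpose (f ≫ ℓ) ((S.ext X).obj f ≫ ℓ)).surjective
      ((S.atil f).hom ▷ ℓ ≫ (α_ (T.unit X) ((S.ext X).obj f) ℓ).hom)
  dsimp only at hl
  refine ⟨l, ⟨fun {X f f'} α ↦ hLI.hom_ext ?_, fun f ↦ hl _ f, fun {X Y} f g ↦ hLI.hom_ext ?_⟩⟩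
  · dsimp only
    rw [Bicategory.whiskerLeft_comp, ← reassoc_of% hS'.atil_natural, hl,
      Bicategory.whiskerLeft_comp, reassoc_of% hl, ← comp_whiskerRight_assoc,
      hS.atil_natural]
    simp
  · dsimp only
    simp only [Bicategory.whiskerLeft_comp]
    rw [reassoc_of% hS'.atil_ahat, ← reassoc_of% hS'.atil_natural,
      ← reassoc_of% hS'.atil_natural, reassoc_of% hl]
    have h := congrArg (· ▷ ℓ) (hS.atil_ahat f g)
    simp only [comp_whiskerRight] at h
    rw [← cancel_mono (α_ (T.unit X) (T.ext.obj f ≫ (S.ext Y).obj g) ℓ).inv]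
    simp only [Category.assoc]
    rw [← associator_naturality_middle_assoc, Iso.hom_inv_id, Category.comp_id, h]
    rw [← associator_naturality_right_assoc, ← whisker_exchange_assoc]
    simp

/-- Postcomposition with a left adjoint preserves the universal property of the unit 2-cells
of a lax-idempotent pseudoalgebra. -/
theorem IsLaxIdempotent.bijective_transpose_comp_leftAdjoint {S : T.AlgData C}
    (hS : IsLaxIdempotent S) {ℓ : C ⟶ C'} {r : C' ⟶ C} (adj : Bicategory.Adjunction ℓ r)
    {X : 𝒜} (f : J.obj X ⟶ C) (h : T.obj X ⟶ C') :
    Function.Bijective (fun k : (S.ext X).obj f ≫ ℓ ⟶ h ↦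
      (S.atil f).hom ▷ ℓ ≫ (α_ (T.unit X) ((S.ext X).obj f) ℓ).hom ≫ T.unit X ◁ k) := by
  rw [← adj.homEquiv₂.bijective.of_comp_iff']
  convert ((α_ (T.unit X) h r).symm.homToEquiv (Z := f)).bijective.comp
    ((hS.bijective_transpose f (h ≫ r)).comp adj.homEquiv₂.bijective) using 1
  funext k
  simp only [Function.comp_apply, Adjunction.homEquiv₂_apply]
  rw [Iso.homToEquiv_apply]
  simp only [Bicategory.whiskerLeft_comp, comp_whiskerRight, Category.assoc, Iso.symm_hom]
  rw [← associator_inv_naturality_left_assoc, whisker_exchange_assoc]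
  bicategory

end LaxIdempotent

end RelativePseudomonad

open RelativePseudomonad in
/-- Let `(A, (-)^a, â, ã)` and `(B, (-)^b, b̂, b̃)` be lax-idempotent
`T`-pseudoalgebras.  Every 1-cell `ℓ : A ⟶ B` of `ℰ` admitting a right adjoint in `ℰ` is a
pseudomorphism of `T`-pseudoalgebras: it admits a lax morphism structure, and every lax
morphism structure on it (in particular, the unique one) has invertible components. -/
theorem leftAdjoint_isPseudoMorphism
    {𝒜 : Type u₁} [Bicategory.{w₁, v₁} 𝒜] {ℰ : Type u₂} [Bicategory.{w₂, v₂} ℰ]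
    {J : Pseudofunctor 𝒜 ℰ} (T : RelativePseudomonad J)
    {CA CB : ℰ} (SA : T.AlgData CA) (SB : T.AlgData CB)
    (hA : SA.Laws) (hB : SB.Laws)
    (hLIA : IsLaxIdempotent SA) (hLIB : IsLaxIdempotent SB)
    (ℓ : CA ⟶ CB) (r : CB ⟶ CA) (adj : Bicategory.Adjunction ℓ r) :
    (∃ l : ∀ (X : 𝒜) (f : J.obj X ⟶ CA),
        (SB.ext X).obj (f ≫ ℓ) ⟶ (SA.ext X).obj f ≫ ℓ,
      (⟨ℓ, l⟩ : LaxData SA SB).IsLaxMorphism) ∧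
    (∀ l : ∀ (X : 𝒜) (f : J.obj X ⟶ CA),
        (SB.ext X).obj (f ≫ ℓ) ⟶ (SA.ext X).obj f ≫ ℓ,
      (⟨ℓ, l⟩ : LaxData SA SB).IsLaxMorphism →
        ∀ (X : 𝒜) (f : J.obj X ⟶ CA), IsIso (l X f)) := by
  refine ⟨hLIB.exists_isLaxMorphism hA hB ℓ, fun l hl X f ↦ ?_⟩
  have hφ := hLIA.bijective_transpose_comp_leftAdjoint adj f
  have hlf := hl.unit f
  obtain ⟨s, hs⟩ := (hφ ((SB.ext X).obj (f ≫ ℓ))).surjective (SB.atil (f ≫ ℓ)).hom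
  dsimp only at hs
  have hls : l X f ≫ s = 𝟙 _ := hLIB.hom_ext (by
    rw [Bicategory.whiskerLeft_comp, reassoc_of% hlf, hs]
    simp)
  refine ⟨s, hls, (hφ _).injective ?_⟩
  rw [Bicategory.whiskerLeft_comp, reassoc_of% hs, hlf]
  simp
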